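/- Let μ be the product probability measure on Ω = ℕ → Bool whose coordinates are independent fair coin flips, and let v : Ω → ℕ → Bool be predictable. Define the random round number of the second match, T₂ ω = inf {n ∈ ℕ | the set {k | k < n ∧ ω k = v ω k} has at least 2 elements}. Then T₂ is μ-almost everywhere finite and its expectation is ∫ T₂ dμ = 4. -/

import Mathlib

open MeasureTheory

/-- `μ` is the product probability measure on `Ω = ℕ → Bool` whose coordinates are
independent fair coin flips: every cylinder event fixing the coins on a finite set `s`
of rounds has probability `(1/2)^|s|`.  (Taking `s = ∅` shows `μ` is a probability
measure, and these cylinder probabilities uniquely determine the product measure.) -/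
def IsFairCoinSeq (μ : Measure (ℕ → Bool)) : Prop :=
  ∀ (s : Finset ℕ) (f : ℕ → Bool),
    μ {ω | ∀ k ∈ s, ω k = f k} = (1 / 2 : ENNReal) ^ s.card

/-- `v` is predictable: the round-`k` target depends only on the coins of earlier
rounds. -/
def Predictable (v : (ℕ → Bool) → ℕ → Bool) : Prop :=
  ∀ ω ω' k, (∀ j < k, ω j = ω' j) → v ω k = v ω' k

/-- The round number of the second match: the least `n` such that among the first `n`
rounds there are at least two rounds whose coin equals its target. -/
noncomputable def secondMatchRound (v : (ℕ → Bool) → ℕ → Bool) (ω : ℕ → Bool) : ℕ :=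
  sInf {n : ℕ | 2 ≤ ((Finset.range n).filter (fun k => ω k = v ω k)).card}

/-- The match pattern on the first `n` rounds can be prescribed arbitrarily, and determines the
coins of these rounds. -/
lemma Predictable.exists_forall_match_iff {v : (ℕ → Bool) → ℕ → Bool} (hv : Predictable v)
    (p : ℕ → Prop) (n : ℕ) :
    ∃ g : ℕ → Bool, ∀ ω : ℕ → Bool,
      (∀ k < n, (ω k = v ω k ↔ p k)) ↔ ∀ k < n, ω k = g k := by
  classical
  induction n with
  | zero => exact ⟨fun _ => true, by simp⟩
  | succ n ih =>
    obtain ⟨g, hg⟩ := ih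
    refine ⟨Function.update g n (if p n then v g n else !v g n), fun ω => ?_⟩
    have hcongr : (∀ k < n, ω k = Function.update g n (if p n then v g n else !v g n) k) ↔
        ∀ k < n, ω k = g k :=
      forall₂_congr fun k hk => by rw [Function.update_of_ne hk.ne]
    rw [Nat.forall_lt_succ_right, Nat.forall_lt_succ_right, hg, hcongr, Function.update_self]
    refine and_congr_right fun h => ?_
    rw [hv ω g n h]
    by_cases hp : p n <;> simp [hp, Bool.eq_not]

lemma Predictable.exists_setOf_matches_eq {v : (ℕ → Bool) → ℕ → Bool} (hv : Predictable v)
    {n : ℕ} {S : Finset ℕ} (hS : S ⊆ Finset.range n) :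
    ∃ g : ℕ → Bool, {ω | (Finset.range n).filter (fun k => ω k = v ω k) = S} =
      {ω | ∀ k ∈ Finset.range n, ω k = g k} := by
  obtain ⟨g, hg⟩ := hv.exists_forall_match_iff (· ∈ S) n
  refine ⟨g, Set.ext fun ω => ?_⟩
  simp only [Set.mem_ofPred_eq, Finset.mem_range, ← hg, Finset.ext_iff, Finset.mem_filter]
  refine ⟨fun h k hk => by simp [← h, hk], fun h k => ⟨fun hk => (h k hk.1).1 hk.2, fun hk => ?_⟩⟩
  have hkn := Finset.mem_range.1 (hS hk)
  exact ⟨hkn, (h k hkn).2 hk⟩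

lemma Finset.card_filter_powerset_card_lt_two {α : Type*} (s : Finset α) :
    {t ∈ s.powerset | t.card < 2}.card = s.card + 1 := by
  classical
  have h : {t ∈ s.powerset | t.card < 2} = s.powersetCard 0 ∪ s.powersetCard 1 := by
    ext t
    simp only [Finset.mem_filter, Finset.mem_powerset, Finset.mem_union, Finset.mem_powersetCard,
      ← and_or_left]
    exact and_congr_right fun _ => by omega
  rw [h, Finset.card_union_of_disjoint (Finset.pairwise_disjoint_powersetCard s (by simp))]
  simp [add_comm]

lemma setOf_card_matches_lt_two_eq (v : (ℕ → Bool) → ℕ → Bool) (n : ℕ) :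
    {ω | ((Finset.range n).filter (fun k => ω k = v ω k)).card < 2} =
      ⋃ S ∈ {S ∈ (Finset.range n).powerset | S.card < 2},
        {ω | (Finset.range n).filter (fun k => ω k = v ω k) = S} := by
  ext ω
  simp

lemma measurableSet_cylinder_bool (s : Finset ℕ) (g : ℕ → Bool) :
    MeasurableSet {ω : ℕ → Bool | ∀ k ∈ s, ω k = g k} := by
  have : {ω : ℕ → Bool | ∀ k ∈ s, ω k = g k} = (s : Set ℕ).pi fun k => {g k} := by
    ext; simp [Set.mem_pi]
  rw [this]
  exact MeasurableSet.pi s.countable_toSet fun _ _ => measurableSet_singleton _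

lemma Predictable.measurableSet_setOf_matches_eq {v : (ℕ → Bool) → ℕ → Bool} (hv : Predictable v)
    {n : ℕ} {S : Finset ℕ} (hS : S ⊆ Finset.range n) :
    MeasurableSet {ω | (Finset.range n).filter (fun k => ω k = v ω k) = S} := by
  obtain ⟨g, hg⟩ := hv.exists_setOf_matches_eq hS
  exact hg ▸ measurableSet_cylinder_bool _ g

lemma Predictable.measurableSet_card_matches_lt_two {v : (ℕ → Bool) → ℕ → Bool}
    (hv : Predictable v) (n : ℕ) :
    MeasurableSet {ω | ((Finset.range n).filter (fun k => ω k = v ω k)).card < 2} := by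
  rw [setOf_card_matches_lt_two_eq]
  exact Finset.measurableSet_biUnion _ fun S hS =>
    hv.measurableSet_setOf_matches_eq (Finset.mem_powerset.1 (Finset.mem_filter.1 hS).1)

lemma IsFairCoinSeq.measure_card_matches_lt_two {μ : Measure (ℕ → Bool)} (hμ : IsFairCoinSeq μ)
    {v : (ℕ → Bool) → ℕ → Bool} (hv : Predictable v) (n : ℕ) :
    μ {ω | ((Finset.range n).filter (fun k => ω k = v ω k)).card < 2} =
      (n + 1) * (1 / 2 : ENNReal) ^ n := by
  have hsub : ∀ S ∈ {S ∈ (Finset.range n).powerset | S.card < 2}, S ⊆ Finset.range n :=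
    fun S hS => Finset.mem_powerset.1 (Finset.mem_filter.1 hS).1
  rw [setOf_card_matches_lt_two_eq, measure_biUnion_finset]
  · rw [Finset.sum_congr rfl (g := fun _ => (1 / 2 : ENNReal) ^ n), Finset.sum_const,
      Finset.card_filter_powerset_card_lt_two, Finset.card_range, nsmul_eq_mul]
    · push_cast; rfl
    · intro S hS
      obtain ⟨g, hg⟩ := hv.exists_setOf_matches_eq (hsub S hS)
      rw [hg, hμ, Finset.card_range]
  · intro S _ S' _ hne
    exact Set.disjoint_left.2 fun ω h h' => hne (h.symm.trans h')
  · exact fun S hS => hv.measurableSet_setOf_matches_eq (hsub S hS)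

lemma lt_secondMatchRound_iff {v : (ℕ → Bool) → ℕ → Bool} {ω : ℕ → Bool}
    (h : ∃ n, 2 ≤ ((Finset.range n).filter (fun k => ω k = v ω k)).card) (n : ℕ) :
    n < secondMatchRound v ω ↔
      ((Finset.range n).filter (fun k => ω k = v ω k)).card < 2 := by
  refine ⟨fun hn => not_le.1 fun hle => hn.not_ge (Nat.sInf_le hle), fun hn => not_le.1 fun hle => ?_⟩
  have hmem : 2 ≤ ((Finset.range (secondMatchRound v ω)).filter (fun k => ω k = v ω k)).card :=
    Nat.sInf_mem h
  exact hn.not_ge (hmem.trans (Finset.card_le_card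
    (Finset.filter_subset_filter _ (Finset.range_mono hle))))

lemma tsum_ite_lt (m : ℕ) : ∑' n : ℕ, (if n < m then (1 : ℝ) else 0) = m := by
  rw [tsum_eq_sum (s := Finset.range m) (by simp),
    Finset.sum_congr rfl fun n hn => if_pos (Finset.mem_range.1 hn)]
  simp

lemma hasSum_succ_mul_geometric_two :
    HasSum (fun n : ℕ => ((n : ℝ) + 1) * (1 / 2 : ℝ) ^ n) 4 := by
  have h := (hasSum_coe_mul_geometric_of_norm_lt_one (r := (1 / 2 : ℝ)) (by norm_num)).add
    hasSum_geometric_two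
  norm_num at h
  simpa only [add_mul, one_mul, one_div, inv_pow] using h

/-- The round of the second match is almost surely finite and its expectation is `4`:
two expected rounds for the first match and two more for the second. -/
theorem secondMatchRound_ae_finite_and_expectation_four
    (μ : Measure (ℕ → Bool)) (hμ : IsFairCoinSeq μ)
    (v : (ℕ → Bool) → ℕ → Bool) (hv : Predictable v) :
    (∀ᵐ ω ∂μ, ∃ n, 2 ≤ ((Finset.range n).filter (fun k => ω k = v ω k)).card) ∧
      ∫ ω, (secondMatchRound v ω : ℝ) ∂μ = 4 := by
  have : IsProbabilityMeasure μ := ⟨by simpa using hμ ∅ fun _ => true⟩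
  set A : ℕ → Set (ℕ → Bool) := fun n =>
    {ω | ((Finset.range n).filter (fun k => ω k = v ω k)).card < 2} with hA
  have hmeas : ∀ n, MeasurableSet (A n) := hv.measurableSet_card_matches_lt_two
  have hreal : ∀ n, μ.real (A n) = ((n : ℝ) + 1) * (1 / 2 : ℝ) ^ n := fun n => by
    rw [measureReal_def, hμ.measure_card_matches_lt_two hv n, ENNReal.toReal_mul,
      ENNReal.toReal_pow, ENNReal.toReal_add (by simp) (by simp)]
    simp
  have hfin : ∀ᵐ ω ∂μ, ∃ n, 2 ≤ ((Finset.range n).filter (fun k => ω k = v ω k)).card := by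
    rw [ae_iff, ← measureReal_eq_zero_iff]
    refine le_antisymm (ge_of_tendsto' hasSum_succ_mul_geometric_two.summable.tendsto_atTop_zero
      fun n => ?_) measureReal_nonneg
    rw [← hreal]
    exact measureReal_mono fun ω hω => not_le.1 (not_exists.1 hω n)
  refine ⟨hfin, ?_⟩
  have hint : ∀ n, ∫ ω, (A n).indicator (1 : (ℕ → Bool) → ℝ) ω ∂μ =
      ((n : ℝ) + 1) * (1 / 2 : ℝ) ^ n := fun n => by
    rw [integral_indicator_one (hmeas n), hreal]
  have hnorm : ∀ n ω, ‖(A n).indicator (1 : (ℕ → Bool) → ℝ) ω‖ = (A n).indicator 1 ω :=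
    fun n ω => Real.norm_of_nonneg (Set.indicator_nonneg (fun _ _ => zero_le_one) ω)
  calc ∫ ω, (secondMatchRound v ω : ℝ) ∂μ
      = ∫ ω, ∑' n, (A n).indicator (1 : (ℕ → Bool) → ℝ) ω ∂μ := by
        refine integral_congr_ae (hfin.mono fun ω hω => ?_)
        simp only [Set.indicator_apply, hA, Set.mem_ofPred_eq, ← lt_secondMatchRound_iff hω,
          Pi.one_apply, tsum_ite_lt]
    _ = ∑' n, ∫ ω, (A n).indicator (1 : (ℕ → Bool) → ℝ) ω ∂μ := by
        refine (integral_tsum_of_summable_integral_norm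
          (fun n => (integrable_const (1 : ℝ)).indicator (hmeas n)) ?_).symm
        change Summable fun n => ∫ ω, ‖(A n).indicator (1 : (ℕ → Bool) → ℝ) ω‖ ∂μ
        simp only [hnorm, hint]
        exact hasSum_succ_mul_geometric_two.summable
    _ = 4 := by simp only [hint, hasSum_succ_mul_geometric_two.tsum_eq]
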